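/- Let 0 < α < 1, w > 0 and u₀ ∈ ℝ. Then the function u(t) = u₀·E_α(−w·t^α) satisfies the Caputo fractional differential equation D^α u(t) = −w·u(t) for all t > 0, together with the initial condition u(0) = u₀. -/

import Mathlib

open MeasureTheory

/-- The (left) Caputo fractional derivative of order `α`. -/
noncomputable def caputoDeriv (α : ℝ) (u : ℝ → ℝ) (t : ℝ) : ℝ :=
  (Real.Gamma (1 - α))⁻¹ * ∫ s in (0:ℝ)..t, (t - s) ^ (-α) * deriv u s

/-- The two-parameter Mittag-Leffler function `E_{α,β}(z) = ∑ z^k / Γ(αk+β)`. -/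
noncomputable def mittagLeffler (α β z : ℝ) : ℝ :=
  ∑' k : ℕ, z ^ k / Real.Gamma (α * (k : ℝ) + β)

open Set in
theorem Real.rpow_mul_exp_neg_le_Gamma {M s : ℝ} (hM : 0 < M) (hs : 1 ≤ s) :
    M ^ (s - 1) * Real.exp (-M) ≤ Real.Gamma s := by
  have hint : IntegrableOn (fun x : ℝ => Real.exp (-x) * x ^ (s - 1)) (Ioi 0) :=
    Real.GammaIntegral_convergent (by linarith)
  rw [Real.Gamma_eq_integral (by linarith), ← integral_exp_neg_Ioi M, ← integral_const_mul]
  calc ∫ x in Ioi M, M ^ (s - 1) * Real.exp (-x)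
      ≤ ∫ x in Ioi M, Real.exp (-x) * x ^ (s - 1) := by
        refine setIntegral_mono_on ((integrableOn_exp_neg_Ioi M).const_mul _)
          (hint.mono_set (Ioi_subset_Ioi hM.le)) measurableSet_Ioi fun x hx => ?_
        rw [mul_comm]
        gcongr
        exact (mem_Ioi.mp hx).le
    _ ≤ _ := by
        refine setIntegral_mono_set hint ?_ (Ioi_subset_Ioi hM.le).eventuallyLE
        filter_upwards [ae_restrict_mem measurableSet_Ioi] with x hx
        have : 0 < x := hx
        positivity

theorem summable_mittagLeffler {α : ℝ} (hα : 0 < α) (β z : ℝ) :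
    Summable fun k : ℕ => z ^ k / Real.Gamma (α * (k : ℝ) + β) := by
  set M : ℝ := (2 * |z| + 1) ^ α⁻¹
  have hb : 0 < 2 * |z| + 1 := by positivity
  have hM : 0 < M := by positivity
  have hMα : M ^ α = 2 * |z| + 1 := Real.rpow_inv_rpow hb.le hα.ne'
  have hq : |z| / (2 * |z| + 1) < 1 := by
    rw [div_lt_one hb]; linarith [abs_nonneg z]
  refine Summable.of_norm_bounded_eventually_nat (g := fun k : ℕ =>
    (M ^ (β - 1) * Real.exp (-M))⁻¹ * (|z| / (2 * |z| + 1)) ^ k)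
    ((summable_geometric_of_lt_one (by positivity) hq).mul_left _) ?_
  obtain ⟨N, hN⟩ := exists_nat_ge ((1 - β) / α)
  filter_upwards [Filter.eventually_ge_atTop N] with k hk
  have hs : 1 ≤ α * (k : ℝ) + β := by
    have : (1 - β) / α ≤ k := hN.trans (by exact_mod_cast hk)
    rw [div_le_iff₀ hα] at this
    linarith
  have hΓ := Real.rpow_mul_exp_neg_le_Gamma hM hs
  have he : M ^ (α * (k : ℝ) + β - 1) = (2 * |z| + 1) ^ k * M ^ (β - 1) := by
    rw [add_sub_assoc, Real.rpow_add hM, Real.rpow_mul hM.le, hMα, Real.rpow_natCast]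
  rw [he] at hΓ
  rw [norm_div, norm_pow, Real.norm_eq_abs, Real.norm_eq_abs,
    abs_of_pos (Real.Gamma_pos_of_pos (by linarith))]
  calc |z| ^ k / Real.Gamma (α * (k : ℝ) + β)
      ≤ |z| ^ k / ((2 * |z| + 1) ^ k * M ^ (β - 1) * Real.exp (-M)) := by gcongr
    _ = _ := by rw [div_pow]; field_simp

theorem mittagLeffler_zero (α β : ℝ) : mittagLeffler α β 0 = (Real.Gamma β)⁻¹ := by
  rw [mittagLeffler, tsum_eq_single 0 fun k hk => by simp [hk]]
  simp

theorem hasDerivAt_mittagLeffler_one {α : ℝ} (hα : 0 < α) (z : ℝ) :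
    HasDerivAt (mittagLeffler α 1) (mittagLeffler α α z / α) z := by
  have hterm (r : ℝ) (k : ℕ) :
      ((k + 1 : ℕ) : ℝ) * r ^ (k + 1 - 1) / Real.Gamma (α * ((k + 1 : ℕ) : ℝ) + 1)
        = r ^ k / Real.Gamma (α * (k : ℝ) + α) / α := by
    have hpos : 0 < α * (k : ℝ) + α := by positivity
    have hΓ := (Real.Gamma_pos_of_pos hpos).ne'
    rw [show α * ((k + 1 : ℕ) : ℝ) + 1 = (α * (k : ℝ) + α) + 1 by push_cast; ring,
      Real.Gamma_add_one hpos.ne', Nat.add_sub_cancel, Nat.cast_add_one,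
      show α * (k : ℝ) + α = α * ((k : ℝ) + 1) by ring] at *
    field_simp
  have hsum (r : ℝ) : Summable fun k : ℕ =>
      (k : ℝ) * r ^ (k - 1) / Real.Gamma (α * (k : ℝ) + 1) := by
    rw [← summable_nat_add_iff 1]
    simp_rw [hterm]
    exact (summable_mittagLeffler hα α r).div_const α
  have hz : z ∈ Metric.ball (0 : ℝ) (|z| + 1) := by simp
  have key := hasDerivAt_tsum_of_isPreconnected (hsum (|z| + 1)) Metric.isOpen_ball
    (convex_ball (0 : ℝ) (|z| + 1)).isPreconnected
    (g := fun (k : ℕ) (y : ℝ) => y ^ k / Real.Gamma (α * (k : ℝ) + 1))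
    (fun k y _ => (hasDerivAt_pow k y).div_const _) (fun k y hy => ?_) hz
    (summable_mittagLeffler hα 1 z) hz
  · have hval : ∑' k : ℕ, (k : ℝ) * z ^ (k - 1) / Real.Gamma (α * (k : ℝ) + 1)
        = mittagLeffler α α z / α := by
      rw [(hsum z).tsum_eq_zero_add]
      simp_rw [hterm]
      simp [mittagLeffler, tsum_div_const]
    rw [hval] at key
    exact key
  · have hy' : |y| ≤ |z| + 1 := by simpa using (mem_ball_zero_iff.mp hy).le
    rw [norm_div, norm_mul, norm_pow, Real.norm_eq_abs, Real.norm_eq_abs, Real.norm_eq_abs,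
      Nat.abs_cast, abs_of_pos (Real.Gamma_pos_of_pos (by positivity))]
    have := Real.Gamma_pos_of_pos (show 0 < α * (k : ℝ) + 1 by positivity)
    gcongr

theorem integral_sub_rpow_mul_rpow {b c t : ℝ} (hb : 0 < b) (hc : 0 < c) (ht : 0 < t) :
    ∫ s in (0:ℝ)..t, (t - s) ^ (c - 1) * s ^ (b - 1)
      = t ^ (b + c - 1) * (Real.Gamma b * Real.Gamma c / Real.Gamma (b + c)) := by
  have h := Complex.betaIntegral_scaled b c ht
  rw [Complex.betaIntegral_eq_Gamma_mul_div _ _ (by simpa) (by simpa)] at h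
  apply Complex.ofReal_injective
  rw [← intervalIntegral.integral_ofReal]
  push_cast
  rw [Complex.ofReal_cpow ht.le, ← Complex.Gamma_ofReal, ← Complex.Gamma_ofReal,
    ← Complex.Gamma_ofReal]
  push_cast
  rw [← h]
  refine intervalIntegral.integral_congr fun s hs => ?_
  rw [Set.uIcc_of_le ht.le] at hs
  simp only [Complex.ofReal_cpow hs.1, Complex.ofReal_cpow (sub_nonneg.mpr hs.2)]
  push_cast
  ring

theorem intervalIntegrable_sub_rpow_mul_rpow {b c t : ℝ} (hb : 0 < b) (hc : 0 < c) (ht : 0 < t) :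
    IntervalIntegrable (fun s => (t - s) ^ (c - 1) * s ^ (b - 1)) volume 0 t := by
  by_contra hni
  have h := integral_sub_rpow_mul_rpow hb hc ht
  rw [intervalIntegral.integral_undef hni] at h
  have := Real.Gamma_pos_of_pos hb
  have := Real.Gamma_pos_of_pos hc
  have := Real.Gamma_pos_of_pos (add_pos hb hc)
  have : 0 < t ^ (b + c - 1) * (Real.Gamma b * Real.Gamma c / Real.Gamma (b + c)) := by positivity
  exact this.ne h

/-- The Riemann-Liouville integral of order `c` of `s ^ (β - 1) * E_{α,β}(lam * s ^ α)`. -/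
theorem integral_sub_rpow_mul_mittagLeffler {α β c t : ℝ} (hα : 0 < α) (hβ : 0 < β) (hc : 0 < c)
    (ht : 0 < t) (lam : ℝ) :
    ∫ s in (0:ℝ)..t, (t - s) ^ (c - 1) * (s ^ (β - 1) * mittagLeffler α β (lam * s ^ α))
      = Real.Gamma c * t ^ (β + c - 1) * mittagLeffler α (β + c) (lam * t ^ α) := by
  let a (k : ℕ) : ℝ := lam ^ k / Real.Gamma (α * k + β)
  let K (k : ℕ) (s : ℝ) : ℝ := (t - s) ^ (c - 1) * s ^ (α * k + β - 1)
  have hpos (k : ℕ) : 0 < α * (k : ℝ) + β := by positivity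
  have hint (k : ℕ) : Integrable (K k) (volume.restrict (Set.Ioc 0 t)) :=
    (intervalIntegrable_iff_integrableOn_Ioc_of_le ht.le).mp
      (intervalIntegrable_sub_rpow_mul_rpow (hpos k) hc ht)
  have hval (μ : ℝ) (k : ℕ) : μ ^ k / Real.Gamma (α * k + β) * ∫ s in Set.Ioc 0 t, K k s
      = Real.Gamma c * t ^ (β + c - 1) * ((μ * t ^ α) ^ k / Real.Gamma (α * k + (β + c))) := by
    have := (Real.Gamma_pos_of_pos (hpos k)).ne'
    rw [← intervalIntegral.integral_of_le ht.le, integral_sub_rpow_mul_rpow (hpos k) hc ht,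
      show α * (k : ℝ) + β + c - 1 = α * k + (β + c - 1) by ring, Real.rpow_add ht,
      Real.rpow_mul ht.le, Real.rpow_natCast, mul_pow, add_assoc]
    field_simp
  have hnorm (k : ℕ) : ∫ s in Set.Ioc 0 t, ‖a k * K k s‖
      = |lam| ^ k / Real.Gamma (α * k + β) * ∫ s in Set.Ioc 0 t, K k s := by
    rw [← integral_const_mul]
    refine setIntegral_congr_fun measurableSet_Ioc fun s hs => ?_
    have hK : 0 ≤ K k s :=
      mul_nonneg (Real.rpow_nonneg (sub_nonneg.mpr hs.2) _) (Real.rpow_nonneg hs.1.le _)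
    simp only [a, norm_mul, norm_div, norm_pow, Real.norm_eq_abs, abs_of_nonneg hK,
      abs_of_pos (Real.Gamma_pos_of_pos (hpos k))]
  have key := hasSum_integral_of_summable_integral_norm (F := fun k s => a k * K k s)
    (fun k => (hint k).const_mul (a k)) (by
      simp_rw [hnorm, hval]
      exact (summable_mittagLeffler hα (β + c) _).mul_left _)
  simp_rw [integral_const_mul, a, hval] at key
  rw [intervalIntegral.integral_of_le ht.le, mittagLeffler, ← tsum_mul_left, key.tsum_eq]
  refine setIntegral_congr_fun measurableSet_Ioc fun s hs => ?_
  simp only [mittagLeffler, ← tsum_mul_left]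
  refine tsum_congr fun k => ?_
  simp only [K]
  rw [show α * (k : ℝ) + β - 1 = α * k + (β - 1) by ring, Real.rpow_add hs.1,
    Real.rpow_mul hs.1.le, Real.rpow_natCast, mul_pow]
  ring

theorem hasDerivAt_mittagLeffler_mul_rpow {α : ℝ} (hα : 0 < α) (lam : ℝ) {s : ℝ} (hs : 0 < s) :
    HasDerivAt (fun τ => mittagLeffler α 1 (lam * τ ^ α))
      (lam * (s ^ (α - 1) * mittagLeffler α α (lam * s ^ α))) s := by
  have h := (hasDerivAt_mittagLeffler_one hα (lam * s ^ α)).comp s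
    ((Real.hasDerivAt_rpow_const (p := α) (Or.inl hs.ne')).const_mul lam)
  convert! h using 1
  field_simp

/-- `u(t) = u₀ E_α(−w t^α)` solves the Caputo equation `D^α u = −w u` with `u(0) = u₀`. -/
theorem mittagLeffler_solves_caputo_ode (α w u₀ : ℝ) (hα0 : 0 < α) (hα1 : α < 1)
    (hw : 0 < w) :
    (∀ t : ℝ, 0 < t →
      caputoDeriv α (fun τ => u₀ * mittagLeffler α 1 (-w * τ ^ α)) t
        = -w * (u₀ * mittagLeffler α 1 (-w * t ^ α))) ∧
    u₀ * mittagLeffler α 1 (-w * (0:ℝ) ^ α) = u₀ := by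
  refine ⟨fun t ht => ?_, by simp [Real.zero_rpow hα0.ne', mittagLeffler_zero]⟩
  have hc : 0 < 1 - α := by linarith
  have hΓ := (Real.Gamma_pos_of_pos hc).ne'
  have hI : ∫ s in (0:ℝ)..t,
        (t - s) ^ (-α) * deriv (fun τ => u₀ * mittagLeffler α 1 (-w * τ ^ α)) s
      = u₀ * -w * ∫ s in (0:ℝ)..t,
        (t - s) ^ (1 - α - 1) * (s ^ (α - 1) * mittagLeffler α α (-w * s ^ α)) := by
    rw [← intervalIntegral.integral_const_mul, intervalIntegral.integral_of_le ht.le,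
      intervalIntegral.integral_of_le ht.le]
    refine setIntegral_congr_fun measurableSet_Ioc fun s hs => ?_
    simp only [((hasDerivAt_mittagLeffler_mul_rpow hα0 (-w) hs.1).const_mul u₀).deriv,
      show 1 - α - 1 = -α by ring]
    ring
  rw [caputoDeriv, hI, integral_sub_rpow_mul_mittagLeffler hα0 hα0 hc ht,
    show α + (1 - α) = 1 by ring, sub_self, Real.rpow_zero]
  field_simp
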